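/- arXiv:2102.10093 — 2 statements merged into one kernel-verified Lean document; each statement's English description precedes it below -/
import Mathlib

section
/- Let f ∈ Δ. If there exist two distinct sequences (M_n)_{n∈ℕ}, (M'_n)_{n∈ℕ} ∈ {C1,C2}^ℕ such that ⋂_{n≥0} M_{[0,n)} ℝ³_{≥0} = ℝ_{≥0} f = ⋂_{n≥0} M'_{[0,n)} ℝ³_{≥0}, then dim_ℚ(f) ≤ 2 and neither (M_n) nor (M'_n) is primitive. -/
open Matrix Filter MeasureTheory

noncomputable section

/-- The matrix `C1`. -/
def C1 : Matrix (Fin 3) (Fin 3) ℝ := !![1,1,0; 0,0,1; 0,1,0]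

/-- The matrix `C2`. -/
def C2 : Matrix (Fin 3) (Fin 3) ℝ := !![0,1,0; 1,0,0; 0,1,1]

/-- The product `M 0 * M 1 * ... * M (n-1)`. -/
def pprod (M : ℕ → Matrix (Fin 3) (Fin 3) ℝ) (n : ℕ) : Matrix (Fin 3) (Fin 3) ℝ :=
  ((List.range n).map M).prod

/-- The product `M r * M (r+1) * ... * M (s-1)`. -/
def segProd (M : ℕ → Matrix (Fin 3) (Fin 3) ℝ) (r s : ℕ) : Matrix (Fin 3) (Fin 3) ℝ :=
  ((List.range (s - r)).map (fun k => M (r + k))).prod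

/-- A sequence of nonnegative matrices is primitive if every tail has a finite
initial product with all entries positive. -/
def IsPrimitiveSeq (M : ℕ → Matrix (Fin 3) (Fin 3) ℝ) : Prop :=
  ∀ r : ℕ, ∃ s : ℕ, r < s ∧ ∀ i j, 0 < segProd M r s i j

/-- The image of the nonnegative orthant under `M`. -/
def cone (M : Matrix (Fin 3) (Fin 3) ℝ) : Set (Fin 3 → ℝ) :=
  {y | ∃ x : Fin 3 → ℝ, (∀ i, 0 ≤ x i) ∧ y = M.mulVec x}

/-- The ray generated by `f`. -/
def ray (f : Fin 3 → ℝ) : Set (Fin 3 → ℝ) := {y | ∃ t : ℝ, 0 ≤ t ∧ y = t • f}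

/-- The simplex of nonnegative vectors whose entries sum to 1. -/
def simplex : Set (Fin 3 → ℝ) := {x | (∀ i, 0 ≤ x i) ∧ x 0 + x 1 + x 2 = 1}

/-- The dimension over `ℚ` of the vector space spanned by the entries of `f`. -/
def dimQ (f : Fin 3 → ℝ) : ℕ := Module.finrank ℚ (Submodule.span ℚ (Set.range f))

theorem pprod_succ (M : ℕ → Matrix (Fin 3) (Fin 3) ℝ) (n : ℕ) :
    pprod M (n + 1) = pprod M n * M n := by
  simp [pprod, List.range_succ]

theorem pprod_eq_mul_segProd (M : ℕ → Matrix (Fin 3) (Fin 3) ℝ) {m n : ℕ} (h : m ≤ n) :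
    pprod M n = pprod M m * segProd M m n := by
  obtain ⟨d, rfl⟩ := Nat.exists_eq_add_of_le h
  simp [pprod, segProd, List.range_add, Function.comp_def]

theorem isUnit_C1 : IsUnit C1 := by
  rw [Matrix.isUnit_iff_isUnit_det]
  simp [C1, Matrix.det_fin_three]

theorem isUnit_C2 : IsUnit C2 := by
  rw [Matrix.isUnit_iff_isUnit_det]
  simp [C2, Matrix.det_fin_three]

theorem isUnit_pprod {M : ℕ → Matrix (Fin 3) (Fin 3) ℝ} (hM : ∀ n, M n = C1 ∨ M n = C2) (n : ℕ) :
    IsUnit (pprod M n) := by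
  induction n with
  | zero => simp [pprod]
  | succ n ih =>
    rw [pprod_succ]
    refine ih.mul ?_
    rcases hM n with h | h <;> rw [h]
    exacts [isUnit_C1, isUnit_C2]

theorem exists_intCast_pprod {M : ℕ → Matrix (Fin 3) (Fin 3) ℝ}
    (hM : ∀ n, M n = C1 ∨ M n = C2) (n : ℕ) :
    ∃ N : Matrix (Fin 3) (Fin 3) ℤ, pprod M n = N.map (Int.castRingHom ℝ) := by
  induction n with
  | zero => exact ⟨1, by simp [pprod]⟩
  | succ n ih =>
    obtain ⟨N, hN⟩ := ih
    rw [pprod_succ, hN]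
    rcases hM n with h | h
    · refine ⟨N * !![1,1,0; 0,0,1; 0,1,0], ?_⟩
      rw [Matrix.map_mul, h]
      congr 1
      ext i j
      fin_cases i <;> fin_cases j <;> simp [C1]
    · refine ⟨N * !![0,1,0; 1,0,0; 0,1,1], ?_⟩
      rw [Matrix.map_mul, h]
      congr 1
      ext i j
      fin_cases i <;> fin_cases j <;> simp [C2]

/-- An integer matrix applied to a vector with two equal entries has entries spanning a rational
space of dimension at most two. -/
theorem dimQ_intCast_mulVec_le_two (N : Matrix (Fin 3) (Fin 3) ℤ) {g : Fin 3 → ℝ}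
    (hg : g 0 = g 2) : dimQ (N.map (Int.castRingHom ℝ) *ᵥ g) ≤ 2 := by
  classical
  let S : Finset ℝ := {g 0, g 1}
  have hle : Submodule.span ℚ (Set.range (N.map (Int.castRingHom ℝ) *ᵥ g)) ≤
      Submodule.span ℚ (S : Set ℝ) := by
    rw [Submodule.span_le]
    rintro _ ⟨i, rfl⟩
    have hmem : ∀ j, g j ∈ Submodule.span ℚ (S : Set ℝ) := by
      intro j
      apply Submodule.subset_span
      fin_cases j <;> simp [S, hg]
    simp only [Matrix.mulVec, dotProduct, SetLike.mem_coe]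
    refine (Submodule.span ℚ (S : Set ℝ)).sum_mem fun j _ => ?_
    have := Submodule.smul_mem _ (N i j : ℚ) (hmem j)
    simpa [Rat.smul_def] using this
  exact (Submodule.finrank_mono hle).trans
    ((finrank_span_finset_le_card S).trans Finset.card_le_two)

/-- If a nonzero vector lies in all cones of a sequence and one of its successive coordinate
vectors has a zero entry, then the sequence is not primitive. -/
theorem not_isPrimitiveSeq_of_coord_eq_zero {M : ℕ → Matrix (Fin 3) (Fin 3) ℝ}
    (hM : ∀ n, M n = C1 ∨ M n = C2) {f h : Fin 3 → ℝ} (hf : f ≠ 0)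
    (hcone : ∀ n, f ∈ cone (pprod M n)) {m : ℕ} (hfh : f = pprod M m *ᵥ h) {i : Fin 3}
    (hi : h i = 0) : ¬IsPrimitiveSeq M := by
  intro hprim
  obtain ⟨s, hs, hpos⟩ := hprim m
  obtain ⟨x, hx, hfx⟩ := hcone s
  have hhx : h = segProd M m s *ᵥ x := by
    apply Matrix.mulVec_injective_of_isUnit (isUnit_pprod hM m)
    rw [Matrix.mulVec_mulVec, ← pprod_eq_mul_segProd M hs.le, ← hfx, hfh]
  have hx0 : x = 0 := by
    have hsum : ∑ j, segProd M m s i j * x j = 0 := by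
      rw [← hi, hhx]; rfl
    rw [Finset.sum_eq_zero_iff_of_nonneg fun j _ => mul_nonneg (hpos i j).le (hx j)] at hsum
    ext j
    exact (mul_eq_zero.mp (hsum j (Finset.mem_univ j))).resolve_left (hpos i j).ne'
  exact hf (by rw [hfx, hx0, Matrix.mulVec_zero])

theorem dimQ_le_two_and_not_isPrimitiveSeq_of_branch {f : Fin 3 → ℝ} (hf : f ≠ 0)
    {M M' : ℕ → Matrix (Fin 3) (Fin 3) ℝ}
    (hM : ∀ n, M n = C1 ∨ M n = C2) (hM' : ∀ n, M' n = C1 ∨ M' n = C2)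
    (hcone : ∀ n, f ∈ cone (pprod M n)) (hcone' : ∀ n, f ∈ cone (pprod M' n)) {k : ℕ}
    (hk : pprod M k = pprod M' k) (h1 : M k = C1) (h2 : M' k = C2) :
    dimQ f ≤ 2 ∧ ¬IsPrimitiveSeq M ∧ ¬IsPrimitiveSeq M' := by
  obtain ⟨h, hh, hfh⟩ := hcone (k + 1)
  obtain ⟨h', hh', hfh'⟩ := hcone' (k + 1)
  have heq : C1 *ᵥ h = C2 *ᵥ h' := by
    apply Matrix.mulVec_injective_of_isUnit (isUnit_pprod hM k)
    rw [Matrix.mulVec_mulVec, Matrix.mulVec_mulVec, ← h1, ← h2, ← pprod_succ, hk, ← pprod_succ,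
      ← hfh, ← hfh']
  have e0 : h 0 + h 1 = h' 1 := by
    simpa [C1, C2, Matrix.mulVec, dotProduct, Fin.sum_univ_three] using congrFun heq 0
  have e2 : h 1 = h' 1 + h' 2 := by
    simpa [C1, C2, Matrix.mulVec, dotProduct, Fin.sum_univ_three] using congrFun heq 2
  have z : h 0 = 0 := by linarith [hh 0, hh' 2]
  have z' : h' 2 = 0 := by linarith
  refine ⟨?_, not_isPrimitiveSeq_of_coord_eq_zero hM hf hcone hfh z,
    not_isPrimitiveSeq_of_coord_eq_zero hM' hf hcone' hfh' z'⟩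
  obtain ⟨N, hN⟩ := exists_intCast_pprod hM k
  rw [hfh, pprod_succ, ← Matrix.mulVec_mulVec, hN, h1]
  apply dimQ_intCast_mulVec_le_two
  simp [C1, Matrix.mulVec, dotProduct, Fin.sum_univ_three, z]

theorem two_directive_sequences_implies_nonprimitive
    (f : Fin 3 → ℝ) (hf : f ∈ simplex)
    (M M' : ℕ → Matrix (Fin 3) (Fin 3) ℝ)
    (hM : ∀ n, M n = C1 ∨ M n = C2) (hM' : ∀ n, M' n = C1 ∨ M' n = C2)
    (hne : M ≠ M')
    (hcone : (⋂ n : ℕ, cone (pprod M n)) = ray f)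
    (hcone' : (⋂ n : ℕ, cone (pprod M' n)) = ray f) :
    dimQ f ≤ 2 ∧ ¬IsPrimitiveSeq M ∧ ¬IsPrimitiveSeq M' := by
  have hf0 : f ≠ 0 := by
    rintro rfl
    simpa using hf.2
  have hfray : f ∈ ray f := ⟨1, zero_le_one, (one_smul ℝ f).symm⟩
  have hc : ∀ n, f ∈ cone (pprod M n) := Set.mem_iInter.mp (hcone ▸ hfray)
  have hc' : ∀ n, f ∈ cone (pprod M' n) := Set.mem_iInter.mp (hcone' ▸ hfray)
  classical
  have hex := Function.ne_iff.mp hne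
  have hk : pprod M (Nat.find hex) = pprod M' (Nat.find hex) := by
    refine congrArg List.prod (List.map_congr_left fun j hj => ?_)
    exact not_not.mp (Nat.find_min hex (List.mem_range.mp hj))
  have hd := Nat.find_spec hex
  rcases hM (Nat.find hex) with h1 | h1 <;> rcases hM' (Nat.find hex) with h2 | h2
  · exact absurd (h1.trans h2.symm) hd
  · exact dimQ_le_two_and_not_isPrimitiveSeq_of_branch hf0 hM hM' hc hc' hk h1 h2
  · obtain ⟨hdim, hp', hp⟩ :=
      dimQ_le_two_and_not_isPrimitiveSeq_of_branch hf0 hM' hM hc' hc hk.symm h2 h1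
    exact ⟨hdim, hp, hp'⟩
  · exact absurd (h1.trans h2.symm) hd
end
end

section
/- A sequence (M_n)_{n∈ℕ} ∈ {C1,C2}^ℕ is not primitive if and only if there exists an integer N ≥ 0 such that M_{N+2i} = M_{N+2i+1} for all i ∈ ℕ. -/
open Matrix Filter MeasureTheory

noncomputable section

theorem mul_C1_apply (A : Matrix (Fin 3) (Fin 3) ℝ) (i : Fin 3) :
    (A * C1) i 0 = A i 0 ∧ (A * C1) i 1 = A i 0 + A i 2 ∧ (A * C1) i 2 = A i 1 := by
  simp [C1, Matrix.mul_apply, Fin.sum_univ_three]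

theorem mul_C2_apply (A : Matrix (Fin 3) (Fin 3) ℝ) (i : Fin 3) :
    (A * C2) i 0 = A i 1 ∧ (A * C2) i 1 = A i 0 + A i 2 ∧ (A * C2) i 2 = A i 2 := by
  simp [C2, Matrix.mul_apply, Fin.sum_univ_three]

theorem C1_ne_C2 : C1 ≠ C2 := by
  intro h
  simpa [C1, C2] using congrFun (congrFun h 0) 0

theorem segProd_self (M : ℕ → Matrix (Fin 3) (Fin 3) ℝ) (r : ℕ) : segProd M r r = 1 := by
  simp [segProd]

theorem segProd_add_succ (M : ℕ → Matrix (Fin 3) (Fin 3) ℝ) (r n : ℕ) :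
    segProd M r (r + (n + 1)) = segProd M r (r + n) * M (r + n) := by
  simp [segProd, List.range_succ]

theorem segProd_nonneg {M : ℕ → Matrix (Fin 3) (Fin 3) ℝ}
    (hM : ∀ n, M n = C1 ∨ M n = C2) (r n : ℕ) (i j : Fin 3) :
    0 ≤ segProd M r (r + n) i j := by
  induction n generalizing j with
  | zero =>
    rw [Nat.add_zero, segProd_self, Matrix.one_apply]
    split_ifs <;> norm_num
  | succ n ih =>
    rw [segProd_add_succ]
    have h0 := ih 0
    have h1 := ih 1
    have h2 := ih 2
    rcases hM (r + n) with h | h <;> rw [h]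
    · obtain ⟨e0, e1, e2⟩ := mul_C1_apply (segProd M r (r + n)) i
      fin_cases j <;> simp [e0, e1, e2] <;> linarith
    · obtain ⟨e0, e1, e2⟩ := mul_C2_apply (segProd M r (r + n)) i
      fin_cases j <;> simp [e0, e1, e2] <;> linarith

theorem add_pos_iff_of_nonneg {x y : ℝ} (hx : 0 ≤ x) (hy : 0 ≤ y) :
    0 < x + y ↔ 0 < x ∨ 0 < y := by
  grind

/-- How the support of a row of `segProd` evolves when the next factor is `C1`. -/
theorem segProd_succ_pos_of_C1 {M : ℕ → Matrix (Fin 3) (Fin 3) ℝ}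
    (hM : ∀ n, M n = C1 ∨ M n = C2) {r n : ℕ} (h : M (r + n) = C1) (i : Fin 3) :
    (0 < segProd M r (r + (n + 1)) i 0 ↔ 0 < segProd M r (r + n) i 0) ∧
    (0 < segProd M r (r + (n + 1)) i 1 ↔
      0 < segProd M r (r + n) i 0 ∨ 0 < segProd M r (r + n) i 2) ∧
    (0 < segProd M r (r + (n + 1)) i 2 ↔ 0 < segProd M r (r + n) i 1) := by
  obtain ⟨e0, e1, e2⟩ := mul_C1_apply (segProd M r (r + n)) i
  rw [segProd_add_succ, h, e0, e1, e2,
    add_pos_iff_of_nonneg (segProd_nonneg hM r n i 0) (segProd_nonneg hM r n i 2)]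
  simp

/-- How the support of a row of `segProd` evolves when the next factor is `C2`. -/
theorem segProd_succ_pos_of_C2 {M : ℕ → Matrix (Fin 3) (Fin 3) ℝ}
    (hM : ∀ n, M n = C1 ∨ M n = C2) {r n : ℕ} (h : M (r + n) = C2) (i : Fin 3) :
    (0 < segProd M r (r + (n + 1)) i 0 ↔ 0 < segProd M r (r + n) i 1) ∧
    (0 < segProd M r (r + (n + 1)) i 1 ↔
      0 < segProd M r (r + n) i 0 ∨ 0 < segProd M r (r + n) i 2) ∧
    (0 < segProd M r (r + (n + 1)) i 2 ↔ 0 < segProd M r (r + n) i 2) := by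
  obtain ⟨e0, e1, e2⟩ := mul_C2_apply (segProd M r (r + n)) i
  rw [segProd_add_succ, h, e0, e1, e2,
    add_pos_iff_of_nonneg (segProd_nonneg hM r n i 0) (segProd_nonneg hM r n i 2)]
  simp

/-- A row that is positive stays positive. -/
theorem segProd_row_pos_mono {M : ℕ → Matrix (Fin 3) (Fin 3) ℝ}
    (hM : ∀ n, M n = C1 ∨ M n = C2) {r m n : ℕ} (hmn : m ≤ n) {i : Fin 3}
    (h : ∀ j, 0 < segProd M r (r + m) i j) (j : Fin 3) : 0 < segProd M r (r + n) i j := by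
  induction n, hmn using Nat.le_induction generalizing j with
  | base => exact h j
  | succ n _ ih =>
    rcases hM (r + n) with hn | hn
    · have hs := segProd_succ_pos_of_C1 hM hn i
      fin_cases j
      exacts [hs.1.2 (ih 0), hs.2.1.2 (.inl (ih 0)), hs.2.2.2 (ih 1)]
    · have hs := segProd_succ_pos_of_C2 hM hn i
      fin_cases j
      exacts [hs.1.2 (ih 1), hs.2.1.2 (.inl (ih 0)), hs.2.2.2 (ih 2)]

/-- Let `a n`, `b n`, `c n` record the support of a row after `n` steps, where `P n` says that
step `n` uses `C1`. If the support is nonempty and never full, the steps eventually pair up. -/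
theorem exists_forall_pair_of_support {a b c P : ℕ → Prop}
    (h₁ : ∀ n, P n → (a (n + 1) ↔ a n) ∧ (b (n + 1) ↔ a n ∨ c n) ∧ (c (n + 1) ↔ b n))
    (h₂ : ∀ n, ¬P n → (a (n + 1) ↔ b n) ∧ (b (n + 1) ↔ a n ∨ c n) ∧ (c (n + 1) ↔ c n))
    (h0 : a 0 ∨ b 0 ∨ c 0) (hfull : ∀ n, ¬(a n ∧ b n ∧ c n)) :
    ∃ N, ∀ i, P (N + 2 * i) ↔ P (N + 2 * i + 1) := by
  by_cases hab : ∃ n, a n ∧ b n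
  · obtain ⟨N, hN⟩ := hab
    have key : ∀ k, (a (N + k) ∧ b (N + k)) ∧ ¬P (N + k) := by
      have hP : ∀ n, a n ∧ b n → ¬P n := by grind
      intro k
      induction k with
      | zero => exact ⟨hN, hP _ hN⟩
      | succ k ih =>
        have h := h₂ _ ih.2
        have h' : a (N + (k + 1)) ∧ b (N + (k + 1)) := ⟨h.1.2 ih.1.2, h.2.1.2 (.inl ih.1.1)⟩
        exact ⟨h', hP _ h'⟩
    exact ⟨N, fun i => iff_of_false (key _).2 (key (2 * i + 1)).2⟩
  by_cases hbc : ∃ n, b n ∧ c n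
  · obtain ⟨N, hN⟩ := hbc
    have key : ∀ k, (b (N + k) ∧ c (N + k)) ∧ P (N + k) := by
      have hP : ∀ n, b n ∧ c n → P n := by
        intro n hn
        by_contra hp
        grind
      intro k
      induction k with
      | zero => exact ⟨hN, hP _ hN⟩
      | succ k ih =>
        have h := h₁ _ ih.2
        have h' : b (N + (k + 1)) ∧ c (N + (k + 1)) := ⟨h.2.1.2 (.inr ih.1.2), h.2.2.2 ih.1.1⟩
        exact ⟨h', hP _ h'⟩
    exact ⟨N, fun i => iff_of_true (key _).2 (key (2 * i + 1)).2⟩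
  push Not at hab hbc
  have step : ∀ n, b n → b (n + 2) ∧ (P n ↔ P (n + 1)) := by
    intro n hb
    have ha := hab n
    have hc := hbc n
    have ha1 := hab (n + 1)
    have hc1 := hbc (n + 1)
    have ha2 := hab (n + 2)
    have hc2 := hbc (n + 2)
    have := h₁ n
    have := h₂ n
    have := h₁ (n + 1)
    have := h₂ (n + 1)
    by_cases P n <;> by_cases P (n + 1) <;> simp_all
  obtain ⟨N, hN⟩ : ∃ N, b N := by
    by_cases hb : b 0
    · exact ⟨0, hb⟩
    · refine ⟨1, ?_⟩
      by_cases hp : P 0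
      · exact (h₁ 0 hp).2.1.2 (by tauto)
      · exact (h₂ 0 hp).2.1.2 (by tauto)
  have hb : ∀ i, b (N + 2 * i) := by
    intro i
    induction i with
    | zero => exact hN
    | succ i ih => exact (step _ ih).1
  exact ⟨N, fun i => (step _ (hb i)).2⟩

/-- If the factors pair up from `N` on, the middle row of every even-length product is supported
on the middle entry. -/
theorem segProd_middle_row_even {M : ℕ → Matrix (Fin 3) (Fin 3) ℝ}
    (hM : ∀ n, M n = C1 ∨ M n = C2) {N : ℕ}
    (hN : ∀ i : ℕ, M (N + 2 * i) = M (N + 2 * i + 1)) (i : ℕ) :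
    ¬0 < segProd M N (N + 2 * i) 1 0 ∧ ¬0 < segProd M N (N + 2 * i) 1 2 := by
  induction i with
  | zero => simp [segProd_self]
  | succ i ih =>
    have h' := hN i
    rcases hM (N + 2 * i) with h | h <;> rw [h] at h'
    · have s := segProd_succ_pos_of_C1 hM h 1
      have s' := segProd_succ_pos_of_C1 hM (n := 2 * i + 1) h'.symm 1
      exact ⟨by rw [mul_add, s'.1, s.1]; exact ih.1,
        by rw [mul_add, s'.2.2, s.2.1]; tauto⟩
    · have s := segProd_succ_pos_of_C2 hM h 1
      have s' := segProd_succ_pos_of_C2 hM (n := 2 * i + 1) h'.symm 1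
      exact ⟨by rw [mul_add, s'.1, s.2.1]; tauto,
        by rw [mul_add, s'.2.2, s.2.2]; exact ih.2⟩

/-- If no product starting at `r` is positive, some fixed row is never positive. -/
theorem exists_row_not_pos {M : ℕ → Matrix (Fin 3) (Fin 3) ℝ}
    (hM : ∀ n, M n = C1 ∨ M n = C2) {r : ℕ}
    (hr : ∀ s, r < s → ¬∀ i j, 0 < segProd M r s i j) :
    ∃ i, ∀ n, ¬∀ j, 0 < segProd M r (r + n) i j := by
  by_contra! h
  choose m hm using h
  refine hr (r + (m 0 + m 1 + m 2 + 1)) (by omega) fun i j =>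
    segProd_row_pos_mono hM ?_ (hm i) j
  fin_cases i <;> simp <;> omega

theorem not_primitive_iff (M : ℕ → Matrix (Fin 3) (Fin 3) ℝ)
    (hM : ∀ n, M n = C1 ∨ M n = C2) :
    ¬IsPrimitiveSeq M ↔ ∃ N : ℕ, ∀ i : ℕ, M (N + 2 * i) = M (N + 2 * i + 1) := by
  constructor
  · intro h
    simp only [IsPrimitiveSeq, not_forall, not_exists, not_and] at h
    obtain ⟨r, hr⟩ := h
    obtain ⟨i, hi⟩ := exists_row_not_pos hM fun s hs h => by
      obtain ⟨i, j, hij⟩ := hr s hs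
      exact hij (h i j)
    obtain ⟨N, hN⟩ := exists_forall_pair_of_support
      (a := fun n => 0 < segProd M r (r + n) i 0) (b := fun n => 0 < segProd M r (r + n) i 1)
      (c := fun n => 0 < segProd M r (r + n) i 2) (P := fun n => M (r + n) = C1)
      (fun n hn => segProd_succ_pos_of_C1 hM hn i)
      (fun n hn => segProd_succ_pos_of_C2 hM ((hM _).resolve_left hn) i)
      (by
        have h1 : 0 < segProd M r (r + 0) i i := by simp [segProd_self]
        fin_cases i
        exacts [.inl h1, .inr (.inl h1), .inr (.inr h1)])
      (fun n hn => hi n (by simpa [Fin.forall_fin_succ] using hn))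
    refine ⟨r + N, fun k => ?_⟩
    have hk := hN k
    simp only [← add_assoc] at hk
    rcases hM (r + N + 2 * k) with h | h
    · rw [h, hk.1 h]
    · rw [h, (hM _).resolve_left fun h' => C1_ne_C2 ((hk.2 h').symm.trans h)]
  · rintro ⟨N, hN⟩ hprim
    obtain ⟨s, hs, hpos⟩ := hprim N
    obtain ⟨n, rfl⟩ := Nat.exists_eq_add_of_lt hs
    obtain ⟨k, hk | hk⟩ := Nat.even_or_odd' (n + 1)
    · refine (segProd_middle_row_even hM hN k).1 ?_
      rw [← hk]
      exact hpos 1 0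
    · obtain ⟨e0, e2⟩ := segProd_middle_row_even hM hN k
      have hp := hpos 1 1
      rw [add_assoc, hk] at hp
      rcases hM (N + 2 * k) with h | h
      · exact ((segProd_succ_pos_of_C1 hM h 1).2.1.1 hp).elim e0 e2
      · exact ((segProd_succ_pos_of_C2 hM h 1).2.1.1 hp).elim e0 e2
end
end
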